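/- Let f : [a,b] → ℝ be the affine fractal function defined by a system S = {S₁,...,S_m} of affine maps S_i(x,y) = (p_i x + h_i, q_i y + r_i x + s_i) with 0 < |p_i| < 1 and 0 < |q_i| < 1, and suppose the graph of f is not contained in a straight line. Then the system S satisfies the weak separation property if and only if the projected system S^◊ satisfies the weak separation property. Equivalently: there exists a sequence of elements of F, each distinct from the identity, converging coefficientwise to the identity, if and only if there exists a sequence of elements of F^◊, each distinct from the identity, converging coefficientwise to the identity. -/

import Mathlib

open Set Filter

/-- An affine map of the plane of the form
`(x, y) ↦ (p·x + h, q·y + r·x + s)`, recorded by its coefficients. -/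
structure Aff2 where
  p : ℝ
  h : ℝ
  q : ℝ
  r : ℝ
  s : ℝ

/-- Composition `c ∘ d` at the level of coefficients. -/
def Aff2.comp (c d : Aff2) : Aff2 :=
  ⟨c.p * d.p, c.p * d.h + c.h, c.q * d.q, c.q * d.r + c.r * d.p,
    c.q * d.s + c.r * d.h + c.s⟩

/-- The map of the plane determined by the coefficients. -/
def Aff2.toFun (g : Aff2) : ℝ × ℝ → ℝ × ℝ :=
  fun pt => (g.p * pt.1 + g.h, g.q * pt.2 + g.r * pt.1 + g.s)

/-- Coefficients of the composition `S_{i₁} ∘ ⋯ ∘ S_{i_k}` for a word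
`w = [i₁, …, i_k]`; nonempty words enumerate the semigroup `G` generated by `S`. -/
def wordCoeff {m : ℕ} (S : Fin m → Aff2) : List (Fin m) → Aff2
  | [] => ⟨1, 0, 1, 0, 0⟩
  | i :: w => (S i).comp (wordCoeff S w)

/-- Composition `c ∘ d` of affine maps of `ℝ` represented by coefficient pairs
`(p, h)` acting as `x ↦ p·x + h`. -/
def affComp (c d : ℝ × ℝ) : ℝ × ℝ := (c.1 * d.1, c.1 * d.2 + c.2)

/-- Coefficients of the projected composition `S^◊_{i₁} ∘ ⋯ ∘ S^◊_{i_k}`;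
nonempty words enumerate the semigroup `G^◊` generated by `S^◊`. -/
def wordCoeffProj {m : ℕ} (S : Fin m → Aff2) : List (Fin m) → ℝ × ℝ
  | [] => (1, 0)
  | i :: w => affComp ((S i).p, (S i).h) (wordCoeffProj S w)

theorem wordCoeffProj_eq {m : ℕ} (S : Fin m → Aff2) (w : List (Fin m)) :
    wordCoeffProj S w = ((wordCoeff S w).p, (wordCoeff S w).h) := by
  induction w with
  | nil => rfl
  | cons i w ih => rw [wordCoeffProj, ih]; rfl

theorem wordCoeff_q_ne_zero {m : ℕ} {S : Fin m → Aff2} (hS : ∀ i, (S i).q ≠ 0)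
    (w : List (Fin m)) : (wordCoeff S w).q ≠ 0 := by
  induction w with
  | nil => exact one_ne_zero
  | cons i w ih => exact mul_ne_zero (hS i) ih

/-- A system whose maps send the graph of `f` over `I` into itself has the same property for
all its compositions. -/
theorem wordCoeff_graph {m : ℕ} {S : Fin m → Aff2} {f : ℝ → ℝ} {I : Set ℝ}
    (h : ∀ i, ∀ x ∈ I, (S i).p * x + (S i).h ∈ I ∧
      (S i).q * f x + (S i).r * x + (S i).s = f ((S i).p * x + (S i).h))
    (w : List (Fin m)) : ∀ x ∈ I, (wordCoeff S w).p * x + (wordCoeff S w).h ∈ I ∧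
      (wordCoeff S w).q * f x + (wordCoeff S w).r * x + (wordCoeff S w).s =
        f ((wordCoeff S w).p * x + (wordCoeff S w).h) := by
  induction w with
  | nil => intro x hx; simpa [wordCoeff] using hx
  | cons i w ih =>
    intro x hx
    obtain ⟨h1, h2⟩ := ih x hx
    obtain ⟨h3, h4⟩ := h i _ h1
    simp only [wordCoeff, Aff2.comp]
    have e : (S i).p * (wordCoeff S w).p * x + ((S i).p * (wordCoeff S w).h + (S i).h) =
        (S i).p * ((wordCoeff S w).p * x + (wordCoeff S w).h) + (S i).h := by ring
    rw [e]
    refine ⟨h3, ?_⟩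
    rw [← h4, ← h2]
    ring

/-- If `c` and `d` map the graph of `f` over `I` into itself and `c ∘ g = d`, then `g` maps
the points of the graph that stay over `I` to points of the graph. -/
theorem graph_of_comp_eq {c d g : Aff2} {f : ℝ → ℝ} {I : Set ℝ} (hcq : c.q ≠ 0)
    (hc : ∀ x ∈ I, c.q * f x + c.r * x + c.s = f (c.p * x + c.h))
    (hd : ∀ x ∈ I, d.q * f x + d.r * x + d.s = f (d.p * x + d.h))
    (hcomp : c.comp g = d) {x : ℝ} (hx : x ∈ I) (hgx : g.p * x + g.h ∈ I) :
    g.q * f x + g.r * x + g.s = f (g.p * x + g.h) := by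
  subst hcomp
  have h1 := hc _ hgx
  have h2 := hd x hx
  simp only [Aff2.comp] at h2
  have e : c.p * g.p * x + (c.p * g.h + c.h) = c.p * (g.p * x + g.h) + c.h := by ring
  rw [e, ← h1] at h2
  apply mul_left_cancel₀ hcq
  linear_combination h2

/-- A function with compact graph over `I` is continuous on `I`. -/
theorem continuousOn_of_isCompact_graph {f : ℝ → ℝ} {I : Set ℝ}
    (h : IsCompact {pt : ℝ × ℝ | ∃ x ∈ I, pt = (x, f x)}) : ContinuousOn f I := by
  intro x hx
  have hmem : ∀ᶠ y in nhdsWithin x I,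
      ((y, f y) : ℝ × ℝ) ∈ {pt : ℝ × ℝ | ∃ x ∈ I, pt = (x, f x)} := by
    filter_upwards [self_mem_nhdsWithin] with y hy using ⟨y, hy, rfl⟩
  have key : Tendsto (fun y => ((y, f y) : ℝ × ℝ)) (nhdsWithin x I) (nhds (x, f x)) := by
    refine h.tendsto_nhds_of_unique_mapClusterPt hmem ?_
    rintro _ ⟨y, hy, rfl⟩ hcl
    have h1 : MapClusterPt y (nhdsWithin x I) (fun z : ℝ => z) :=
      hcl.continuousAt_comp continuous_fst.continuousAt
    have h2 : ClusterPt y (nhds x) :=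
      ClusterPt.mono (by simpa [MapClusterPt] using h1) nhdsWithin_le_nhds
    rw [eq_of_nhds_neBot h2]
  exact (continuous_snd.tendsto _).comp key

/-- A function continuous on `[a, b]` that is not affine there has three points of its graph
over `(a, b)` that are not collinear. -/
theorem exists_noncollinear_graph {a b : ℝ} (hab : a < b) {f : ℝ → ℝ}
    (hf : ContinuousOn f (Icc a b))
    (hline : ¬ ∃ A B : ℝ, ∀ x ∈ Icc a b, f x = A * x + B) :
    ∃ x ∈ Ioo a b, ∃ y ∈ Ioo a b, ∃ z ∈ Ioo a b, x ≠ y ∧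
      (f z - f x) * (y - x) ≠ (f y - f x) * (z - x) := by
  by_contra! hcon
  obtain ⟨x, hax, hxb⟩ := exists_between hab
  obtain ⟨y, hxy, hyb⟩ := exists_between hxb
  have hyx : y - x ≠ 0 := (sub_pos.2 hxy).ne'
  apply hline
  refine ⟨(f y - f x) / (y - x), f x - (f y - f x) / (y - x) * x, ?_⟩
  have hsub : Icc a b ⊆ closure (Ioo a b) := by rw [closure_Ioo hab.ne]
  have heq : EqOn f (fun z => (f y - f x) / (y - x) * z + (f x - (f y - f x) / (y - x) * x))
      (Ioo a b) := by
    intro z hz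
    have := hcon x ⟨hax, hxb⟩ y ⟨hax.trans hxy, hyb⟩ z hz hxy.ne
    simp only
    field_simp
    linear_combination this
  exact heq.of_subset_closure hf (by fun_prop) Ioo_subset_Icc_self hsub

/-- Convergence of `q f + r x + s` to `f` at three non-collinear points of the graph of `f`
forces convergence of the coefficients. -/
theorem tendsto_coeff_of_noncollinear {f : ℝ → ℝ} {q r s : ℕ → ℝ} {x y z : ℝ} (hxy : x ≠ y)
    (hnc : (f z - f x) * (y - x) ≠ (f y - f x) * (z - x))
    (hx : Tendsto (fun n => q n * f x + r n * x + s n) atTop (nhds (f x)))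
    (hy : Tendsto (fun n => q n * f y + r n * y + s n) atTop (nhds (f y)))
    (hz : Tendsto (fun n => q n * f z + r n * z + s n) atTop (nhds (f z))) :
    Tendsto q atTop (nhds 1) ∧ Tendsto r atTop (nhds 0) ∧ Tendsto s atTop (nhds 0) := by
  have hD : (f z - f x) * (y - x) - (f y - f x) * (z - x) ≠ 0 := sub_ne_zero.2 hnc
  have hyx : y - x ≠ 0 := sub_ne_zero.2 hxy.symm
  have hq : Tendsto q atTop (nhds 1) := by
    have := ((((hz.sub hx).mul_const (y - x)).sub ((hy.sub hx).mul_const (z - x))).div_const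
      ((f z - f x) * (y - x) - (f y - f x) * (z - x)))
    rw [div_self hD] at this
    refine this.congr fun n => ?_
    rw [div_eq_iff hD]
    ring
  have hr : Tendsto r atTop (nhds 0) := by
    have := (((hy.sub hx).sub (hq.mul_const (f y - f x))).div_const (y - x))
    rw [one_mul, sub_self, zero_div] at this
    refine this.congr fun n => ?_
    rw [div_eq_iff hyx]
    ring
  refine ⟨hq, hr, ?_⟩
  have := (hx.sub (hq.mul_const (f x))).sub (hr.mul_const x)
  rw [one_mul, sub_self, zero_mul, sub_zero] at this
  exact this.congr fun n => by ring

/-- Every equation `c ∘ g = d` whose projection is solved by `e` has a solution projecting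
to `e`. -/
theorem exists_comp_eq_of_affComp_eq {c d : Aff2} {e : ℝ × ℝ} (hcq : c.q ≠ 0)
    (h : affComp (c.p, c.h) e = (d.p, d.h)) :
    ∃ g : Aff2, c.comp g = d ∧ g.p = e.1 ∧ g.h = e.2 := by
  obtain ⟨h1, h2⟩ := Prod.ext_iff.1 h
  simp only [affComp] at h1 h2
  refine ⟨⟨e.1, e.2, d.q / c.q, (d.r - c.r * e.1) / c.q, (d.s - c.r * e.2 - c.s) / c.q⟩,
    ?_, rfl, rfl⟩
  obtain ⟨dp, dh, dq, dr, ds⟩ := d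
  simp only [Aff2.comp, Aff2.mk.injEq]
  refine ⟨h1, h2, ?_, ?_, ?_⟩ <;> field_simp <;> ring

/-- **Lemma 5.** Let `f` be the affine fractal function on `[a,b]` defined by a system
`S` with `0 < |pᵢ| < 1`, `0 < |qᵢ| < 1`, whose graph is not contained in a straight
line.  Then `S` satisfies the weak separation property iff `S^◊` does; equivalently,
there is a sequence of elements of `F = G⁻¹ ∘ G` distinct from the identity converging
coefficientwise to the identity iff there is such a sequence in
`F^◊ = (G^◊)⁻¹ ∘ G^◊`. -/
theorem wsp_iff_wsp_proj {m : ℕ} (a b : ℝ) (hab : a < b)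
    (S : Fin m → Aff2)
    (hp : ∀ i, 0 < |(S i).p| ∧ |(S i).p| < 1)
    (hq : ∀ i, 0 < |(S i).q| ∧ |(S i).q| < 1)
    (f : ℝ → ℝ)
    (hcompact : IsCompact {pt : ℝ × ℝ | ∃ x ∈ Icc a b, pt = (x, f x)})
    (hattr : {pt : ℝ × ℝ | ∃ x ∈ Icc a b, pt = (x, f x)} =
      ⋃ i : Fin m, (S i).toFun '' {pt : ℝ × ℝ | ∃ x ∈ Icc a b, pt = (x, f x)})
    (hnotline : ¬ ∃ A B : ℝ, ∀ x ∈ Icc a b, f x = A * x + B) :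
    (∃ g : ℕ → Aff2,
        (∀ n, ∃ u v : List (Fin m), u ≠ [] ∧ v ≠ [] ∧
          (wordCoeff S v).comp (g n) = wordCoeff S u) ∧
        (∀ n, g n ≠ ⟨1, 0, 1, 0, 0⟩) ∧
        Tendsto (fun n => (g n).p) atTop (nhds 1) ∧
        Tendsto (fun n => (g n).h) atTop (nhds 0) ∧
        Tendsto (fun n => (g n).q) atTop (nhds 1) ∧
        Tendsto (fun n => (g n).r) atTop (nhds 0) ∧
        Tendsto (fun n => (g n).s) atTop (nhds 0)) ↔
    (∃ g : ℕ → ℝ × ℝ,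
        (∀ n, ∃ u v : List (Fin m), u ≠ [] ∧ v ≠ [] ∧
          affComp (wordCoeffProj S v) (g n) = wordCoeffProj S u) ∧
        (∀ n, g n ≠ (1, 0)) ∧
        Tendsto (fun n => (g n).1) atTop (nhds 1) ∧
        Tendsto (fun n => (g n).2) atTop (nhds 0)) := by
  have hS : ∀ i, ∀ x ∈ Icc a b, (S i).p * x + (S i).h ∈ Icc a b ∧
      (S i).q * f x + (S i).r * x + (S i).s = f ((S i).p * x + (S i).h) := by
    intro i x hx
    have hmem : (S i).toFun (x, f x) ∈ {pt : ℝ × ℝ | ∃ x ∈ Icc a b, pt = (x, f x)} := by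
      rw [hattr]
      exact mem_iUnion.2 ⟨i, mem_image_of_mem _ ⟨x, hx, rfl⟩⟩
    obtain ⟨y, hy, hxy⟩ := hmem
    obtain ⟨h1, h2⟩ := Prod.ext_iff.1 hxy
    simp only [Aff2.toFun] at h1 h2
    rw [h1]
    exact ⟨hy, h2⟩
  have hqne : ∀ i, (S i).q ≠ 0 := fun i => abs_pos.1 (hq i).1
  have hgraph : ∀ (u v : List (Fin m)) (g : Aff2),
      (wordCoeff S v).comp g = wordCoeff S u → ∀ x ∈ Icc a b, g.p * x + g.h ∈ Icc a b →
        g.q * f x + g.r * x + g.s = f (g.p * x + g.h) :=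
    fun u v g hg x hx hgx => graph_of_comp_eq (wordCoeff_q_ne_zero hqne v)
      (fun x hx => (wordCoeff_graph hS v x hx).2) (fun x hx => (wordCoeff_graph hS u x hx).2)
      hg hx hgx
  constructor
  · rintro ⟨g, hg, hne, htp, hth, -, -, -⟩
    refine ⟨fun n => ((g n).p, (g n).h), fun n => ?_, fun n hid => hne n ?_, htp, hth⟩
    · obtain ⟨u, v, hu, hv, huv⟩ := hg n
      refine ⟨u, v, hu, hv, ?_⟩
      rw [wordCoeffProj_eq, wordCoeffProj_eq, ← huv]
      rfl
    · obtain ⟨u, v, -, -, huv⟩ := hg n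
      obtain ⟨h1, h2⟩ := Prod.ext_iff.1 hid
      simp only at h1 h2
      have hfix : ∀ x ∈ Icc a b, (g n).q * f x + (g n).r * x + (g n).s = f x := by
        intro x hx
        have := hgraph u v (g n) huv x hx
        simp only [h1, h2, one_mul, add_zero] at this
        exact this hx
      have hq1 : (g n).q = 1 := by
        by_contra hq1
        have hq1' : 1 - (g n).q ≠ 0 := sub_ne_zero.2 (Ne.symm hq1)
        refine hnotline ⟨(g n).r / (1 - (g n).q), (g n).s / (1 - (g n).q), fun x hx => ?_⟩
        field_simp
        linear_combination -hfix x hx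
      have ha := hfix a (left_mem_Icc.2 hab.le)
      have hb := hfix b (right_mem_Icc.2 hab.le)
      rw [hq1] at ha hb
      have hr0 : (g n).r = 0 := by
        apply mul_right_cancel₀ (sub_pos.2 hab).ne'
        linear_combination hb - ha
      have hs0 : (g n).s = 0 := by
        rw [hr0] at ha
        linear_combination ha
      revert h1 h2 hq1 hr0 hs0
      cases g n
      simp +contextual
  · rintro ⟨e, he, hne, ht1, ht2⟩
    have hlift : ∀ n, ∃ g : Aff2, (∃ u v : List (Fin m), u ≠ [] ∧ v ≠ [] ∧
        (wordCoeff S v).comp g = wordCoeff S u) ∧ g.p = (e n).1 ∧ g.h = (e n).2 := by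
      intro n
      obtain ⟨u, v, hu, hv, huv⟩ := he n
      rw [wordCoeffProj_eq, wordCoeffProj_eq] at huv
      obtain ⟨g, hg, hgp, hgh⟩ := exists_comp_eq_of_affComp_eq (wordCoeff_q_ne_zero hqne v) huv
      exact ⟨g, ⟨u, v, hu, hv, hg⟩, hgp, hgh⟩
    choose g hg hgp hgh using hlift
    have htp : Tendsto (fun n => (g n).p) atTop (nhds 1) := ht1.congr fun n => (hgp n).symm
    have hth : Tendsto (fun n => (g n).h) atTop (nhds 0) := ht2.congr fun n => (hgh n).symm
    have hf := continuousOn_of_isCompact_graph hcompact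
    have hlim : ∀ x ∈ Ioo a b,
        Tendsto (fun n => (g n).q * f x + (g n).r * x + (g n).s) atTop (nhds (f x)) := by
      intro x hx
      have hnhds : Icc a b ∈ nhds x := Icc_mem_nhds hx.1 hx.2
      have hlin : Tendsto (fun n => (g n).p * x + (g n).h) atTop (nhds x) := by
        simpa using (htp.mul_const x).add hth
      refine ((hf.continuousAt hnhds).tendsto.comp hlin).congr' ?_
      filter_upwards [hlin.eventually_mem hnhds] with n hn
      obtain ⟨u, v, -, -, huv⟩ := hg n
      exact (hgraph u v (g n) huv x (Ioo_subset_Icc_self hx) hn).symm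
    obtain ⟨x, hx, y, hy, z, hz, hxy, hnc⟩ := exists_noncollinear_graph hab hf hnotline
    refine ⟨g, hg, fun n hid => hne n ?_, htp, hth,
      tendsto_coeff_of_noncollinear hxy hnc (hlim x hx) (hlim y hy) (hlim z hz)⟩
    rw [Prod.ext_iff, ← hgp n, ← hgh n, hid]
    exact ⟨rfl, rfl⟩
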